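/- With a and b as defined: the function a is increasing (nondecreasing) on [0,1] and continuous on (0,1]; the function b is decreasing (nonincreasing) on [0,1] and continuous on [0,1). -/

import Mathlib

open MeasureTheory ProbabilityTheory Filter

namespace TwoGroup

/-- The two-group random mixture model: a σ-finite base measure on the sample space `𝒳`,
a null proportion `π0 ∈ (0,1)`, and null/non-null probability density functions `f0`, `f1`
with respect to the base measure. -/
structure Model (𝒳 : Type*) [MeasurableSpace 𝒳] where
  base : Measure 𝒳
  sigmaFinite : SigmaFinite base
  π0 : ℝ
  π0_mem : π0 ∈ Set.Ioo (0 : ℝ) 1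
  f0 : 𝒳 → ℝ
  f1 : 𝒳 → ℝ
  f0_meas : Measurable f0
  f1_meas : Measurable f1
  f0_nonneg : ∀ x, 0 ≤ f0 x
  f1_nonneg : ∀ x, 0 ≤ f1 x
  f0_prob : IsProbabilityMeasure (base.withDensity fun x => ENNReal.ofReal (f0 x))
  f1_prob : IsProbabilityMeasure (base.withDensity fun x => ENNReal.ofReal (f1 x))

namespace Model

variable {𝒳 : Type*} [MeasurableSpace 𝒳] (M : Model 𝒳)

/-- The non-null proportion `π1 = 1 - π0`. -/
noncomputable def π1 : ℝ := 1 - M.π0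

/-- The marginal density `f = π0 f0 + π1 f1`. -/
noncomputable def f (x : 𝒳) : ℝ := M.π0 * M.f0 x + M.π1 * M.f1 x

/-- The local false discovery rate `Lfdr(x) = π0 f0(x) / f(x)`. -/
noncomputable def Lfdr (x : 𝒳) : ℝ := M.π0 * M.f0 x / M.f x

/-- The joint law of a single pair `(θ, X)`; `true` encodes `θ = 1` (non-null). -/
noncomputable def joint : Measure (Bool × 𝒳) :=
  (ENNReal.ofReal M.π0) •
      ((Measure.dirac false).prod (M.base.withDensity fun x => ENNReal.ofReal (M.f0 x))) +
    (ENNReal.ofReal M.π1) •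
      ((Measure.dirac true).prod (M.base.withDensity fun x => ENNReal.ofReal (M.f1 x)))

/-- The joint law of `((θ1, X1), …, (θn, Xn))`: i.i.d. copies of `(θ, X)`. -/
noncomputable def jointN (n : ℕ) : Measure (Fin n → Bool × 𝒳) :=
  Measure.pi fun _ => M.joint

end Model

/-- Number of rejections `Σ_i δ_i`. -/
def nRej {n : ℕ} (d : Fin n → Bool) : ℝ := ∑ i, if d i then (1 : ℝ) else 0

/-- Number of false discoveries `Σ_i δ_i (1 - θ_i)`. -/
def nFD {n : ℕ} (θ d : Fin n → Bool) : ℝ :=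
  ∑ i, (if d i then (1 : ℝ) else 0) * (if θ i then (0 : ℝ) else 1)

/-- Number of acceptances `Σ_i (1 - δ_i)`. -/
def nAcc {n : ℕ} (d : Fin n → Bool) : ℝ := ∑ i, if d i then (0 : ℝ) else 1

/-- Number of false non-discoveries `Σ_i (1 - δ_i) θ_i`. -/
def nFN {n : ℕ} (θ d : Fin n → Bool) : ℝ :=
  ∑ i, (if d i then (0 : ℝ) else 1) * (if θ i then (1 : ℝ) else 0)

/-- False discovery proportion. -/
noncomputable def FDP {n : ℕ} (θ d : Fin n → Bool) : ℝ := nFD θ d / max 1 (nRej d)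

/-- False non-discovery proportion. -/
noncomputable def FNP {n : ℕ} (θ d : Fin n → Bool) : ℝ := nFN θ d / max 1 (nAcc d)

/-- A decision rule is a Markov kernel from `𝒳^n` to `{0,1}^n`: a measurable family of
probability measures on `Fin n → Bool`. -/
def IsRule {𝒳 : Type*} [MeasurableSpace 𝒳] {n : ℕ}
    (κ : (Fin n → 𝒳) → Measure (Fin n → Bool)) : Prop :=
  Measurable κ ∧ ∀ x, IsProbabilityMeasure (κ x)

namespace Model

variable {𝒳 : Type*} [MeasurableSpace 𝒳] (M : Model 𝒳)

/-- The false discovery rate `FDR = E[FDP]` of a (randomized) decision rule. -/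
noncomputable def FDR (n : ℕ) (κ : (Fin n → 𝒳) → Measure (Fin n → Bool)) : ℝ :=
  ∫ ω, ∫ d, FDP (fun i => (ω i).1) d ∂(κ fun i => (ω i).2) ∂(M.jointN n)

/-- The false non-discovery rate `FNR = E[FNP]` of a (randomized) decision rule. -/
noncomputable def FNR (n : ℕ) (κ : (Fin n → 𝒳) → Measure (Fin n → Bool)) : ℝ :=
  ∫ ω, ∫ d, FNP (fun i => (ω i).1) d ∂(κ fun i => (ω i).2) ∂(M.jointN n)

/-- The marginal FDR `mFDR = E[Σ δi (1-θi)] / E[Σ δi]` (with `0/0 = 0`). -/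
noncomputable def mFDR (n : ℕ) (κ : (Fin n → 𝒳) → Measure (Fin n → Bool)) : ℝ :=
  (∫ ω, ∫ d, nFD (fun i => (ω i).1) d ∂(κ fun i => (ω i).2) ∂(M.jointN n)) /
    (∫ ω, ∫ d, nRej d ∂(κ fun i => (ω i).2) ∂(M.jointN n))

/-- The marginal FNR `mFNR = E[Σ (1-δi) θi] / E[Σ (1-δi)]` (with `0/0 = 0`). -/
noncomputable def mFNR (n : ℕ) (κ : (Fin n → 𝒳) → Measure (Fin n → Bool)) : ℝ :=
  (∫ ω, ∫ d, nFN (fun i => (ω i).1) d ∂(κ fun i => (ω i).2) ∂(M.jointN n)) /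
    (∫ ω, ∫ d, nAcc d ∂(κ fun i => (ω i).2) ∂(M.jointN n))

/-- `FNR*_n(α)`: the minimum FNR over decision rules controlling FDR at level `α`. -/
noncomputable def FNRstar (n : ℕ) (α : ℝ) : ℝ :=
  sInf {r | ∃ κ : (Fin n → 𝒳) → Measure (Fin n → Bool),
    IsRule κ ∧ M.FDR n κ ≤ α ∧ r = M.FNR n κ}

/-- The minimum mFNR over decision rules for `n` hypotheses controlling mFDR at level `α`. -/
noncomputable def mFNRstarN (n : ℕ) (α : ℝ) : ℝ :=
  sInf {r | ∃ κ : (Fin n → 𝒳) → Measure (Fin n → Bool),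
    IsRule κ ∧ M.mFDR n κ ≤ α ∧ r = M.mFNR n κ}

/-- `mFNR*(α)` (this quantity does not depend on the number of hypotheses; we take `n = 1`). -/
noncomputable def mFNRstar (α : ℝ) : ℝ := M.mFNRstarN 1 α

/-- The marginal law of a single observation `X ∼ f`. -/
noncomputable def Pmix : Measure 𝒳 := M.base.withDensity fun x => ENNReal.ofReal (M.f x)

/-- The law of `W = Lfdr(X)`, `X ∼ f`. -/
noncomputable def νW : Measure ℝ := M.Pmix.map M.Lfdr

/-- `G(t) = P(W ≤ t)`. -/
noncomputable def G (t : ℝ) : ℝ := (M.νW (Set.Iic t)).toReal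

/-- `Ḡ(t) = P(W < t)`. -/
noncomputable def Gbar (t : ℝ) : ℝ := (M.νW (Set.Iio t)).toReal

/-- The generalized inverse `G^{-1}(u) = inf{t : G(t) ≥ u}`. -/
noncomputable def Ginv (u : ℝ) : ℝ := sInf {t | u ≤ M.G t}

/-- `P(W = t)`. -/
noncomputable def atom (t : ℝ) : ℝ := (M.νW {t}).toReal

/-- The randomization probability `p(u)`, satisfying
`Ḡ(G^{-1}(u)) + p(u) P(W = G^{-1}(u)) = u`. -/
noncomputable def pu (u : ℝ) : ℝ := (u - M.Gbar (M.Ginv u)) / M.atom (M.Ginv u)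

/-- `a(u) = E[W | S_u = 1]` for `u ∈ (0,1]`, `a(0) = 0`, where `S_u` is the Bernoulli(u)
thresholding variable of `W` at `G^{-1}(u)` with randomization `p(u)` at the boundary. -/
noncomputable def a (u : ℝ) : ℝ :=
  if u = 0 then 0
  else ((∫ w in Set.Iio (M.Ginv u), w ∂M.νW) + M.pu u * (M.Ginv u * M.atom (M.Ginv u))) / u

/-- `b(u) = E[1 - W | S_u = 0]` for `u ∈ [0,1)`, `b(1) = 0`. -/
noncomputable def b (u : ℝ) : ℝ :=
  if u = 1 then 0
  else ((∫ w in Set.Ioi (M.Ginv u), (1 - w) ∂M.νW)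
      + (1 - M.pu u) * ((1 - M.Ginv u) * M.atom (M.Ginv u))) / (1 - u)

/-- `b*(α) = inf{b(u) : u ∈ [0,1], a(u) ≤ α}`. -/
noncomputable def bstar (α : ℝ) : ℝ :=
  sInf {y | ∃ u ∈ Set.Icc (0 : ℝ) 1, M.a u ≤ α ∧ y = M.b u}

/-- `u*(α) = sup{u ∈ [0,1] : a(u) ≤ α}`. -/
noncomputable def ustar (α : ℝ) : ℝ :=
  sSup {u | u ∈ Set.Icc (0 : ℝ) 1 ∧ M.a u ≤ α}

/-- `b**(α) = inf{E[b(U)] : U a [0,1]-valued random variable with E[a(U)] ≤ α}`. -/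
noncomputable def bstarstar (α : ℝ) : ℝ :=
  sInf {y | ∃ ρ : Measure ℝ, IsProbabilityMeasure ρ ∧ (∀ᵐ u ∂ρ, u ∈ Set.Icc (0 : ℝ) 1) ∧
    (∫ u, M.a u ∂ρ) ≤ α ∧ y = ∫ u, M.b u ∂ρ}

end Model

/-- The Bernoulli(p) measure on `Bool`. -/
noncomputable def bern (p : ℝ) : Measure Bool :=
  (ENNReal.ofReal p) • Measure.dirac true + (ENNReal.ofReal (1 - p)) • Measure.dirac false

namespace Model

variable {𝒳 : Type*} [MeasurableSpace 𝒳] (M : Model 𝒳)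

/-- The per-observation rejection probability of the Neyman–Pearson rule at level `α`:
reject if `Lfdr(x) < G^{-1}(u*(α))`, randomize with probability `p(u*(α))` at equality,
and accept otherwise. -/
noncomputable def qNP (α : ℝ) (x : 𝒳) : ℝ :=
  if M.Lfdr x < M.Ginv (M.ustar α) then 1
  else if M.Lfdr x = M.Ginv (M.ustar α) then M.pu (M.ustar α)
  else 0

/-- The Neyman–Pearson rule `δ^n_NP(α)`, as a Markov kernel: independent randomized
likelihood-ratio tests applied to each observation. -/
noncomputable def NP (α : ℝ) (n : ℕ) : (Fin n → 𝒳) → Measure (Fin n → Bool) :=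
  fun x => Measure.pi fun i => bern (M.qNP α (x i))

/-- The probability (over data and the randomization of the rule `κ`) that the decision vector
lies in the set `E θ` (which may depend on the true labels `θ`). -/
noncomputable def prob (n : ℕ) (κ : (Fin n → 𝒳) → Measure (Fin n → Bool))
    (E : (Fin n → Bool) → Set (Fin n → Bool)) : ℝ :=
  (∫⁻ ω, κ (fun i => (ω i).2) (E fun i => (ω i).1) ∂(M.jointN n)).toReal

end Model

/-- `sortedVal n w i` is the `i`-th order statistic `w_(i)` (for `1 ≤ i ≤ n`) of
`w 0, …, w (n-1)`. -/
noncomputable def sortedVal (n : ℕ) (w : Fin n → ℝ) (i : ℕ) : ℝ :=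
  ((Multiset.map w Finset.univ.val).sort (· ≤ ·)).getD (i - 1) 0

/-- `avgLow n w k = (1/k) Σ_{i=1}^k w_(i)` (equal to `0` when `k = 0`). -/
noncomputable def avgLow (n : ℕ) (w : Fin n → ℝ) (k : ℕ) : ℝ :=
  (∑ i ∈ Finset.Icc 1 k, sortedVal n w i) / k

/-- `avgHigh n w k = (1/(n-k)) Σ_{i=k+1}^n (1 - w_(i))` (equal to `0` when `k = n`). -/
noncomputable def avgHigh (n : ℕ) (w : Fin n → ℝ) (k : ℕ) : ℝ :=
  (∑ i ∈ Finset.Icc (k + 1) n, (1 - sortedVal n w i)) / ((n : ℝ) - k)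

/-- The greatest convex minorant on `[0,1]` of a function `h`, evaluated at `α`. -/
noncomputable def gcm (h : ℝ → ℝ) (α : ℝ) : ℝ :=
  sSup {y | ∃ C : ℝ → ℝ, ConvexOn ℝ (Set.Icc 0 1) C ∧
    (∀ t ∈ Set.Icc (0 : ℝ) 1, C t ≤ h t) ∧ y = C α}

end TwoGroup

namespace TwoGroup

/-- The mean shortfall `E[(t - W)⁺]` below the level `t` of a random variable `W` with law `ν`. -/
noncomputable def shortfall (ν : Measure ℝ) (t : ℝ) : ℝ := ∫ w, max (t - w) 0 ∂ν

section Shortfall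

variable {ν : Measure ℝ} [IsFiniteMeasure ν]

lemma shortfall_nonneg (ν : Measure ℝ) (t : ℝ) : 0 ≤ shortfall ν t :=
  integral_nonneg fun _ => le_max_right _ _

lemma integrable_shortfall (hν : Integrable (fun w => w) ν) (t : ℝ) :
    Integrable (fun w => max (t - w) 0) ν :=
  ((integrable_const t).sub hν).pos_part

/-- Any number between `P(W < s)` and `P(W ≤ s)` is a subgradient of the shortfall at `s`. -/
lemma shortfall_subgradient (hν : Integrable (fun w => w) ν) {s v : ℝ}
    (h₁ : ν.real (Set.Iio s) ≤ v) (h₂ : v ≤ ν.real (Set.Iic s)) (t : ℝ) :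
    v * (t - s) ≤ shortfall ν t - shortfall ν s := by
  have key : ∀ E : Set ℝ, MeasurableSet E →
      (∀ w, E.indicator (fun _ => t - s) w ≤ max (t - w) 0 - max (s - w) 0) →
      ν.real E * (t - s) ≤ shortfall ν t - shortfall ν s := by
    intro E hE h
    rw [shortfall, shortfall,
      ← integral_sub (integrable_shortfall hν t) (integrable_shortfall hν s),
      ← smul_eq_mul, ← integral_indicator_const _ hE]
    exact integral_mono ((integrable_const _).indicator hE)
      ((integrable_shortfall hν t).sub (integrable_shortfall hν s)) h
  rcases le_total s t with hst | hst
  · refine (mul_le_mul_of_nonneg_right h₂ (sub_nonneg.2 hst)).trans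
      (key _ measurableSet_Iic fun w => ?_)
    by_cases hw : w ∈ Set.Iic s
    · rw [Set.indicator_of_mem hw]
      rw [Set.mem_Iic] at hw
      rw [max_eq_left (by linarith), max_eq_left (by linarith)]
      linarith
    · rw [Set.indicator_of_notMem hw]
      have := max_le_max_right 0 (sub_le_sub_right hst w)
      linarith
  · refine (mul_le_mul_of_nonpos_right h₁ (sub_nonpos.2 hst)).trans
      (key _ measurableSet_Iio fun w => ?_)
    by_cases hw : w ∈ Set.Iio s
    · rw [Set.indicator_of_mem hw]
      rw [Set.mem_Iio] at hw
      rw [max_eq_left (show 0 ≤ s - w by linarith)]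
      linarith [le_max_left (t - w) 0]
    · rw [Set.indicator_of_notMem hw]
      rw [Set.mem_Iio, not_lt] at hw
      rw [max_eq_right (show s - w ≤ 0 by linarith)]
      linarith [le_max_right (t - w) 0]

lemma setIntegral_Iio_id (hν : Integrable (fun w => w) ν) (s : ℝ) :
    ∫ w in Set.Iio s, w ∂ν = s * ν.real (Set.Iio s) - shortfall ν s := by
  have h : shortfall ν s = ∫ w in Set.Iio s, (s - w) ∂ν := by
    rw [shortfall, ← integral_indicator measurableSet_Iio]
    refine integral_congr_ae (.of_forall fun w => ?_)
    by_cases hw : w < s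
    · rw [Set.indicator_of_mem (Set.mem_Iio.2 hw)]
      exact max_eq_left (by linarith)
    · rw [Set.indicator_of_notMem (by simpa using hw)]
      exact max_eq_right (by linarith)
  rw [h, integral_sub (integrable_const s) hν.integrableOn, setIntegral_const, smul_eq_mul]
  ring

end Shortfall

namespace Model

variable {𝒳 : Type*} [MeasurableSpace 𝒳] (M : Model 𝒳)

lemma Lfdr_mem_Icc (x : 𝒳) : M.Lfdr x ∈ Set.Icc (0 : ℝ) 1 := by
  have h0 : 0 ≤ M.π0 * M.f0 x := mul_nonneg M.π0_mem.1.le (M.f0_nonneg x)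
  have h1 : 0 ≤ M.π1 * M.f1 x := mul_nonneg (sub_nonneg.2 M.π0_mem.2.le) (M.f1_nonneg x)
  exact ⟨div_nonneg h0 (add_nonneg h0 h1),
    div_le_one_of_le₀ (le_add_of_nonneg_right h1) (add_nonneg h0 h1)⟩

lemma measurable_Lfdr : Measurable M.Lfdr :=
  (M.f0_meas.const_mul _).div ((M.f0_meas.const_mul _).add (M.f1_meas.const_mul _))

instance isProbabilityMeasure_Pmix : IsProbabilityMeasure M.Pmix := by
  have hπ1 : 0 ≤ M.π1 := sub_nonneg.2 M.π0_mem.2.le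
  have h0 := M.f0_prob.measure_univ
  have h1 := M.f1_prob.measure_univ
  constructor
  rw [withDensity_apply _ .univ, Measure.restrict_univ] at h0 h1
  rw [Pmix, withDensity_apply _ .univ, Measure.restrict_univ]
  have h : ∀ x, ENNReal.ofReal (M.f x) = ENNReal.ofReal M.π0 * ENNReal.ofReal (M.f0 x) +
      ENNReal.ofReal M.π1 * ENNReal.ofReal (M.f1 x) := fun x => by
    rw [← ENNReal.ofReal_mul M.π0_mem.1.le, ← ENNReal.ofReal_mul hπ1, ← ENNReal.ofReal_add
      (mul_nonneg M.π0_mem.1.le (M.f0_nonneg x)) (mul_nonneg hπ1 (M.f1_nonneg x)), f]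
  simp_rw [h]
  rw [lintegral_add_left (M.f0_meas.ennreal_ofReal.const_mul _),
    lintegral_const_mul _ M.f0_meas.ennreal_ofReal,
    lintegral_const_mul _ M.f1_meas.ennreal_ofReal, h0, h1, mul_one, mul_one,
    ← ENNReal.ofReal_add M.π0_mem.1.le hπ1, π1, add_sub_cancel, ENNReal.ofReal_one]

instance isProbabilityMeasure_νW : IsProbabilityMeasure M.νW :=
  Measure.isProbabilityMeasure_map M.measurable_Lfdr.aemeasurable

lemma ae_νW_mem : ∀ᵐ w ∂M.νW, w ∈ Set.Icc (0 : ℝ) 1 :=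
  (ae_map_iff M.measurable_Lfdr.aemeasurable measurableSet_Icc).2
    (.of_forall M.Lfdr_mem_Icc)

lemma integrable_id_νW : Integrable (fun w => w) M.νW :=
  .of_mem_Icc 0 1 aemeasurable_id M.ae_νW_mem

lemma G_eq_zero {t : ℝ} (ht : t < 0) : M.G t = 0 := by
  have h : M.νW (Set.Iic t) = 0 := by
    refine measure_mono_null (fun w hw => ?_) M.ae_νW_mem
    exact fun h => absurd (h.1.trans hw) (not_le.2 ht)
  rw [G, h, ENNReal.toReal_zero]

lemma Gbar_zero : M.Gbar 0 = 0 := by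
  have h : M.νW (Set.Iio 0) = 0 := by
    refine measure_mono_null (fun w hw => ?_) M.ae_νW_mem
    exact fun h => absurd (Set.mem_Iio.1 hw) (not_lt.2 h.1)
  rw [Gbar, h, ENNReal.toReal_zero]

lemma G_one : M.G 1 = 1 := by
  have h : M.νW (Set.Iic 1) = 1 :=
    (prob_compl_eq_zero_iff measurableSet_Iic).1 (M.ae_νW_mem.mono fun w hw => hw.2)
  rw [G, h, ENNReal.toReal_one]

lemma G_eq_cdf (t : ℝ) : M.G t = cdf M.νW t := (cdf_eq_real _ _).symm

lemma Ginv_zero : M.Ginv 0 = 0 := by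
  have h : {t | 0 ≤ M.G t} = Set.univ := Set.eq_univ_of_forall fun _ => ENNReal.toReal_nonneg
  rw [Ginv, h, Real.sInf_univ]

lemma zero_mem_lowerBounds {u : ℝ} (hu : 0 < u) : 0 ∈ lowerBounds {t | u ≤ M.G t} := by
  intro t ht
  by_contra! h
  exact absurd (hu.trans_le ht) (by simp [M.G_eq_zero h])

lemma Ginv_mem {u : ℝ} (hu : u ∈ Set.Icc (0 : ℝ) 1) : M.Ginv u ∈ Set.Icc (0 : ℝ) 1 := by
  rcases hu.1.eq_or_lt with rfl | h
  · simp [M.Ginv_zero]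
  · have h1 : (1 : ℝ) ∈ {t | u ≤ M.G t} := by simpa [M.G_one] using hu.2
    exact ⟨le_csInf ⟨1, h1⟩ (M.zero_mem_lowerBounds h), csInf_le ⟨0, M.zero_mem_lowerBounds h⟩ h1⟩

lemma Gbar_Ginv_le {u : ℝ} (hu : u ∈ Set.Icc (0 : ℝ) 1) : M.Gbar (M.Ginv u) ≤ u := by
  rcases hu.1.eq_or_lt with rfl | h
  · rw [M.Ginv_zero, M.Gbar_zero]
  · have hlim : Tendsto (cdf M.νW) (nhdsWithin (M.Ginv u) (Set.Iio (M.Ginv u)))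
        (nhds (Function.leftLim (cdf M.νW) (M.Ginv u))) :=
      (monotone_cdf M.νW).tendsto_leftLim _
    have hle : Function.leftLim (cdf M.νW) (M.Ginv u) ≤ u := by
      refine le_of_tendsto hlim (eventually_nhdsWithin_of_forall fun t ht => ?_)
      by_contra! hc
      rw [← M.G_eq_cdf] at hc
      exact absurd (csInf_le ⟨0, M.zero_mem_lowerBounds h⟩ hc.le) (not_le.2 ht)
    have hm : M.νW (Set.Iio (M.Ginv u)) =
        ENNReal.ofReal (Function.leftLim (cdf M.νW) (M.Ginv u) - 0) := by
      conv_lhs => rw [← measure_cdf M.νW]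
      exact StieltjesFunction.measure_Iio _ (tendsto_cdf_atBot _) _
    rw [Gbar, hm, sub_zero]
    exact ENNReal.toReal_le_of_le_ofReal hu.1 (ENNReal.ofReal_le_ofReal hle)

lemma le_G_Ginv {u : ℝ} (hu : u ∈ Set.Icc (0 : ℝ) 1) : u ≤ M.G (M.Ginv u) := by
  rcases hu.1.eq_or_lt with rfl | h
  · exact ENNReal.toReal_nonneg
  · have hlim : Tendsto (cdf M.νW) (nhdsWithin (M.Ginv u) (Set.Ioi (M.Ginv u)))
        (nhds (cdf M.νW (M.Ginv u))) :=
      ((cdf M.νW).right_continuous _).mono_left (nhdsWithin_mono _ Set.Ioi_subset_Ici_self)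
    rw [M.G_eq_cdf]
    refine ge_of_tendsto hlim (eventually_nhdsWithin_of_forall fun t ht => ?_)
    obtain ⟨s, hs, hst⟩ := exists_lt_of_csInf_lt
      ⟨1, by simpa [M.G_one] using hu.2⟩ (show sInf {t | u ≤ M.G t} < t from ht)
    exact (show u ≤ M.G s from hs).trans (M.G_eq_cdf s ▸ monotone_cdf _ hst.le)

lemma G_eq_Gbar_add_atom (t : ℝ) : M.G t = M.Gbar t + M.atom t := by
  have h : Set.Iic t = Set.Iio t ∪ {t} := by simp
  change M.νW.real (Set.Iic t) = M.νW.real (Set.Iio t) + M.νW.real {t}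
  rw [h, measureReal_union (by simp) (measurableSet_singleton t)]

lemma pu_mul_atom {u : ℝ} (hu : u ∈ Set.Icc (0 : ℝ) 1) :
    M.pu u * M.atom (M.Ginv u) = u - M.Gbar (M.Ginv u) := by
  by_cases h : M.atom (M.Ginv u) = 0
  · have h₁ := M.Gbar_Ginv_le hu
    have h₂ := M.le_G_Ginv hu
    rw [M.G_eq_Gbar_add_atom] at h₂
    rw [h, mul_zero]
    linarith
  · exact div_mul_cancel₀ _ h

/-- The partial mean `E[W S_u] = sup_t (t u - E[(t - W)⁺])`, which is attained at `G^{-1}(u)`. -/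
noncomputable def partialMean (u : ℝ) : ℝ := M.Ginv u * u - shortfall M.νW (M.Ginv u)

lemma partialMean_add_le {u v : ℝ} (hv : v ∈ Set.Icc (0 : ℝ) 1) :
    M.partialMean u + M.Ginv u * (v - u) ≤ M.partialMean v := by
  have h := shortfall_subgradient M.integrable_id_νW (M.Gbar_Ginv_le hv) (M.le_G_Ginv hv)
    (M.Ginv u)
  rw [partialMean, partialMean]
  linarith

lemma setIntegral_Iio_add_eq {u : ℝ} (hu : u ∈ Set.Icc (0 : ℝ) 1) :
    (∫ w in Set.Iio (M.Ginv u), w ∂M.νW) + M.pu u * (M.Ginv u * M.atom (M.Ginv u)) =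
      M.partialMean u := by
  have h := M.pu_mul_atom hu
  rw [setIntegral_Iio_id M.integrable_id_νW, partialMean]
  change _ * M.Gbar _ - _ + _ = _
  linear_combination M.Ginv u * h

lemma a_eq {u : ℝ} (hu : u ∈ Set.Ioc (0 : ℝ) 1) : M.a u = M.partialMean u / u := by
  rw [a, if_neg hu.1.ne', M.setIntegral_Iio_add_eq ⟨hu.1.le, hu.2⟩]

lemma partialMean_one : M.partialMean 1 = ∫ w, w ∂M.νW := by
  have h : shortfall M.νW (M.Ginv 1) = ∫ w, (M.Ginv 1 - w) ∂M.νW := by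
    have hG : M.νW (Set.Iic (M.Ginv 1)) = 1 := by
      refine le_antisymm prob_le_one ?_
      have := M.le_G_Ginv (Set.right_mem_Icc.2 zero_le_one)
      rw [G] at this
      simpa using (ENNReal.ofReal_le_iff_le_toReal (measure_ne_top _ _)).2 this
    have hae : ∀ᵐ w ∂M.νW, w ∈ Set.Iic (M.Ginv 1) :=
      (prob_compl_eq_zero_iff measurableSet_Iic).2 hG
    exact integral_congr_ae (hae.mono fun w hw => max_eq_left (sub_nonneg.2 hw))
  rw [partialMean, h, integral_sub (integrable_const _) M.integrable_id_νW]
  simp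

lemma b_eq {u : ℝ} (hu : u ∈ Set.Ico (0 : ℝ) 1) :
    M.b u = (1 - u - (M.partialMean 1 - M.partialMean u)) / (1 - u) := by
  have hu' : u ∈ Set.Icc (0 : ℝ) 1 := ⟨hu.1, hu.2.le⟩
  have hint : Integrable (fun w : ℝ => 1 - w) M.νW :=
    (integrable_const (1 : ℝ)).sub M.integrable_id_νW
  have hsplit := integral_add_compl (measurableSet_Iic (a := M.Ginv u)) hint
  have hIic : ∫ w in Set.Iic (M.Ginv u), (1 - w) ∂M.νW =
      (∫ w in Set.Iio (M.Ginv u), (1 - w) ∂M.νW) +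
        (1 - M.Ginv u) * M.atom (M.Ginv u) := by
    have h : Set.Iic (M.Ginv u) = Set.Iio (M.Ginv u) ∪ {M.Ginv u} := by simp
    rw [h, setIntegral_union (by simp) (measurableSet_singleton _) hint.integrableOn
      hint.integrableOn, integral_singleton, smul_eq_mul, mul_comm (M.νW.real _)]
    rfl
  have hIio : ∫ w in Set.Iio (M.Ginv u), (1 - w) ∂M.νW =
      M.Gbar (M.Ginv u) - ∫ w in Set.Iio (M.Ginv u), w ∂M.νW := by
    rw [integral_sub (integrable_const _) M.integrable_id_νW.integrableOn, setIntegral_const,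
      smul_eq_mul, mul_one]
    rfl
  have htot : ∫ w, (1 - w) ∂M.νW = 1 - M.partialMean 1 := by
    rw [integral_sub (integrable_const _) M.integrable_id_νW, M.partialMean_one]
    simp
  rw [Set.compl_Iic] at hsplit
  rw [b, if_neg hu.2.ne]
  congr 1
  linear_combination hsplit - hIic - hIio + htot - M.pu_mul_atom hu' +
    M.setIntegral_Iio_add_eq hu'

lemma partialMean_le {u : ℝ} : M.partialMean u ≤ M.Ginv u * u :=
  sub_le_self _ (shortfall_nonneg _ _)

lemma continuousOn_partialMean : ContinuousOn M.partialMean (Set.Icc 0 1) := by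
  refine (LipschitzOnWith.of_le_add_mul (K := 1) fun u hu v hv => ?_).continuousOn
  have h := M.partialMean_add_le (u := u) hv
  have hq := M.Ginv_mem hu
  have habs : |u - v| * M.Ginv u ≤ |u - v| := mul_le_of_le_one_right (abs_nonneg _) hq.2
  have := mul_le_mul_of_nonneg_right (le_abs_self (u - v)) hq.1
  rw [Real.dist_eq, NNReal.coe_one, one_mul]
  linarith

lemma partialMean_nonneg {u : ℝ} (hu : u ∈ Set.Icc (0 : ℝ) 1) : 0 ≤ M.partialMean u := by
  have h := M.partialMean_add_le (u := 0) hu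
  have h0 : shortfall M.νW 0 = 0 := by
    rw [shortfall]
    exact integral_eq_zero_of_ae (M.ae_νW_mem.mono fun w hw =>
      max_eq_right (by linarith [hw.1]))
  simpa [partialMean, M.Ginv_zero, h0] using h

lemma monotoneOn_a : MonotoneOn M.a (Set.Icc 0 1) := by
  intro u hu v hv huv
  rcases hu.1.eq_or_lt with rfl | hu0
  · rcases hv.1.eq_or_lt with rfl | hv0
    · rfl
    · rw [M.a_eq ⟨hv0, hv.2⟩, a, if_pos rfl]
      exact div_nonneg (M.partialMean_nonneg hv) hv.1
  · have hv0 := hu0.trans_le huv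
    rw [M.a_eq ⟨hu0, hu.2⟩, M.a_eq ⟨hv0, hv.2⟩, div_le_div_iff₀ hu0 hv0]
    have h₁ := mul_le_mul_of_nonneg_right (M.partialMean_add_le (u := u) hv) hu.1
    have h₂ := mul_le_mul_of_nonneg_right (M.partialMean_le (u := u)) (sub_nonneg.2 huv)
    linarith

lemma antitoneOn_b : AntitoneOn M.b (Set.Icc 0 1) := by
  intro u hu v hv huv
  have h1 : (1 : ℝ) ∈ Set.Icc (0 : ℝ) 1 := Set.right_mem_Icc.2 zero_le_one
  rcases hv.2.eq_or_lt with rfl | hv1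
  · rcases hu.2.eq_or_lt with rfl | hu1
    · rfl
    · rw [M.b_eq ⟨hu.1, hu1⟩, b, if_pos rfl]
      have h := M.partialMean_add_le (u := 1) hu
      have hq := mul_le_mul_of_nonneg_right (M.Ginv_mem h1).2 (sub_nonneg.2 hu.2)
      exact div_nonneg (by linarith) (sub_nonneg.2 hu.2)
  · have hu1 := huv.trans_lt hv1
    rw [M.b_eq ⟨hu.1, hu1⟩, M.b_eq ⟨hv.1, hv1⟩,
      div_le_div_iff₀ (sub_pos.2 hv1) (sub_pos.2 hu1)]
    have h₁ := mul_le_mul_of_nonneg_right (M.partialMean_add_le (u := v) hu)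
      (sub_nonneg.2 hv.2)
    have h₂ := mul_le_mul_of_nonneg_right (M.partialMean_add_le (u := v) h1)
      (sub_nonneg.2 huv)
    linarith

lemma continuousOn_a : ContinuousOn M.a (Set.Ioc 0 1) :=
  ((M.continuousOn_partialMean.mono Set.Ioc_subset_Icc_self).div continuousOn_id
    fun _ hu => hu.1.ne').congr fun _ hu => M.a_eq hu

lemma continuousOn_b : ContinuousOn M.b (Set.Ico 0 1) := by
  have h := M.continuousOn_partialMean.mono Set.Ico_subset_Icc_self
  exact (((continuousOn_const.sub continuousOn_id).sub (continuousOn_const.sub h)).div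
    (continuousOn_const.sub continuousOn_id) fun _ hu => (sub_pos.2 hu.2).ne').congr
    fun _ hu => M.b_eq hu

end Model

/-- **Properties of `a` and `b`** (Lemma 1): `a` is nondecreasing on `[0,1]` and continuous on
`(0,1]`; `b` is nonincreasing on `[0,1]` and continuous on `[0,1)`. -/
theorem a_b_monotone_continuous {𝒳 : Type*} [MeasurableSpace 𝒳] (M : Model 𝒳) :
    MonotoneOn M.a (Set.Icc 0 1) ∧ ContinuousOn M.a (Set.Ioc 0 1) ∧
    AntitoneOn M.b (Set.Icc 0 1) ∧ ContinuousOn M.b (Set.Ico 0 1) :=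
  ⟨M.monotoneOn_a, M.continuousOn_a, M.antitoneOn_b, M.continuousOn_b⟩

end TwoGroup
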